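/- Let U, V be domains in ℝⁿ (n ≥ 2), each different from ℝⁿ, and let f : ∂_H U → ∂_H V be an isometry of the Hausdorff boundaries in the relative metrics. Suppose ]x,y[ is a boundary interval for U, generating the elements x̃, ỹ ∈ ∂_H U, and set x' = p f(x̃), y' = p f(ỹ). Then ]x',y'[ is a boundary interval for V and |x' − y'| = |x − y|. -/

import Mathlib

open Set Metric Filter

noncomputable section

/-- Euclidean `n`-space. -/
abbrev Euc (n : ℕ) := EuclideanSpace ℝ (Fin n)

/-- A domain: a nonempty open connected subset of Euclidean space. -/
def IsEucDomain {n : ℕ} (U : Set (Euc n)) : Prop := IsOpen U ∧ IsConnected U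

/-- Intrinsic extended distance inside `S`: the infimum of the lengths (total
variations) of continuous paths joining `x` and `y` within `S`. -/
def intrinsicDist {n : ℕ} (S : Set (Euc n)) (x y : Euc n) : ENNReal :=
  ⨅ (γ : ℝ → Euc n) (_ : ContinuousOn γ (Icc (0:ℝ) 1)) (_ : γ 0 = x) (_ : γ 1 = y)
    (_ : MapsTo γ (Icc (0:ℝ) 1) S), eVariationOn γ (Icc (0:ℝ) 1)

/-- A Cauchy sequence (in the intrinsic metric) of points of `U` that does not
converge (in the intrinsic metric) to a point of `U`; such sequences represent
elements of the Hausdorff boundary of `U`. -/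
structure HBSeq {n : ℕ} (U : Set (Euc n)) where
  seq : ℕ → Euc n
  mem : ∀ k, seq k ∈ U
  cauchy : ∀ ε : ENNReal, 0 < ε → ∃ N : ℕ, ∀ j ≥ N, ∀ k ≥ N,
    intrinsicDist U (seq j) (seq k) < ε
  notConv : ¬ ∃ u ∈ U, Tendsto (fun k => intrinsicDist U (seq k) u) atTop (nhds 0)

/-- Two Cauchy sequences represent the same Hausdorff-boundary element iff the
intrinsic distance between corresponding terms tends to `0`. -/
def HBEquiv {n : ℕ} (U : Set (Euc n)) (s t : HBSeq U) : Prop :=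
  Tendsto (fun k => intrinsicDist U (s.seq k) (t.seq k)) atTop (nhds 0)

/-- The Hausdorff boundary of `U`: points of the completion of `(U, ρ_U)` not
corresponding to points of `U`. -/
def HausdorffBoundary {n : ℕ} (U : Set (Euc n)) : Type := Quot (HBEquiv U)

/-- The relative metric on the Hausdorff boundary (the completion metric). -/
def hbDist {n : ℕ} {U : Set (Euc n)} (a b : HausdorffBoundary U) : ENNReal :=
  limsup (fun k => intrinsicDist U ((Quot.out a).seq k) ((Quot.out b).seq k)) atTop

/-- The support of a Hausdorff-boundary element: the Euclidean limit of a
representing Cauchy sequence. -/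
def hbSupport {n : ℕ} {U : Set (Euc n)} (a : HausdorffBoundary U) : Euc n :=
  limUnder atTop (Quot.out a).seq

/-- A (bijective) isometry of Hausdorff boundaries in the relative metrics. -/
def IsHBIsometry {n : ℕ} {U V : Set (Euc n)}
    (f : HausdorffBoundary U → HausdorffBoundary V) : Prop :=
  Function.Bijective f ∧ ∀ a b : HausdorffBoundary U, hbDist (f a) (f b) = hbDist a b

/-- `U` is uniquely determined in the class `𝒰` by the relative metric of its
Hausdorff boundary: any member of `𝒰` with Hausdorff boundary isometric (in the
relative metrics) to that of `U` is the image of `U` under a Euclidean isometry. -/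
def UniquelyDeterminedIn {n : ℕ} (𝒰 : Set (Set (Euc n))) (U : Set (Euc n)) : Prop :=
  ∀ V ∈ 𝒰, (∃ f : HausdorffBoundary U → HausdorffBoundary V, IsHBIsometry f) →
    ∃ J : Euc n ≃ᵢ Euc n, J '' U = V

/-- `]x,y[` is a boundary interval for `U`. -/
def IsBoundaryInterval {n : ℕ} (U : Set (Euc n)) (x y : Euc n) : Prop :=
  x ≠ y ∧ x ∈ frontier U ∧ y ∈ frontier U ∧ openSegment ℝ x y ⊆ U

/-- The Hausdorff-boundary element `a` is generated by the boundary interval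
`]x,y[` at its endpoint `x`: it is represented by a Cauchy sequence of points of
`]x,y[` converging (in the Euclidean metric) to `x`. -/
def GeneratesEndpoint {n : ℕ} (U : Set (Euc n)) (x y : Euc n)
    (a : HausdorffBoundary U) : Prop :=
  ∃ s : HBSeq U, Quot.mk (HBEquiv U) s = a ∧ (∀ k, s.seq k ∈ openSegment ℝ x y) ∧
    Tendsto s.seq atTop (nhds x)

open scoped Topology ENNReal

section IntrinsicDist

variable {n : ℕ} {S : Set (Euc n)}

theorem intrinsicDist_le_eVariationOn {γ : ℝ → Euc n} {a b : ℝ} (hab : a ≤ b)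
    (hc : ContinuousOn γ (Icc a b)) (hm : MapsTo γ (Icc a b) S) :
    intrinsicDist S (γ a) (γ b) ≤ eVariationOn γ (Icc a b) := by
  set φ : ℝ → ℝ := fun t => a + t * (b - a)
  have hφm : Monotone φ := fun s t hst => by
    simp only [φ]; nlinarith
  have hφ : MapsTo φ (Icc 0 1) (Icc a b) := fun t ht => by
    constructor <;> simp only [φ] <;> nlinarith [ht.1, ht.2]
  have hφc : Continuous φ := by fun_prop
  refine le_trans ?_ (eVariationOn.comp_le_of_monotoneOn γ φ (hφm.monotoneOn _) hφ)
  exact iInf_le_of_le (γ ∘ φ) <| iInf_le_of_le (hc.comp hφc.continuousOn hφ) <|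
    iInf_le_of_le (by simp [φ]) <| iInf_le_of_le (by simp [φ]) <|
    iInf_le_of_le (hm.comp hφ) le_rfl

theorem exists_path_of_intrinsicDist_lt {x y : Euc n} {c : ℝ≥0∞}
    (h : intrinsicDist S x y < c) :
    ∃ γ : ℝ → Euc n, ContinuousOn γ (Icc (0:ℝ) 1) ∧ γ 0 = x ∧ γ 1 = y ∧
      MapsTo γ (Icc (0:ℝ) 1) S ∧ eVariationOn γ (Icc (0:ℝ) 1) < c := by
  simp only [intrinsicDist, iInf_lt_iff] at h
  obtain ⟨γ, h1, h2, h3, h4, h5⟩ := h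
  exact ⟨γ, h1, h2, h3, h4, h5⟩

theorem edist_le_intrinsicDist (x y : Euc n) : edist x y ≤ intrinsicDist S x y := by
  refine le_iInf fun γ => le_iInf fun _ => le_iInf fun h0 => le_iInf fun h1 => le_iInf fun _ => ?_
  rw [← h0, ← h1]
  exact eVariationOn.edist_le γ (by simp) (by simp)

theorem intrinsicDist_self {x : Euc n} (hx : x ∈ S) : intrinsicDist S x x = 0 := by
  have := intrinsicDist_le_eVariationOn (S := S) (γ := fun _ => x) (zero_le_one' ℝ)
    continuousOn_const (fun _ _ => hx)
  rwa [eVariationOn.constant_on, nonpos_iff_eq_zero] at this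
  exact (subsingleton_singleton (a := x)).anti (by rintro _ ⟨_, _, rfl⟩; rfl)

theorem intrinsicDist_comm_le (x y : Euc n) : intrinsicDist S x y ≤ intrinsicDist S y x := by
  refine le_of_forall_gt fun c hc => ?_
  obtain ⟨γ, h1, h2, h3, h4, h5⟩ := exists_path_of_intrinsicDist_lt hc
  have hφ : MapsTo (fun t : ℝ => 1 - t) (Icc 0 1) (Icc 0 1) := fun t ht => by
    constructor <;> linarith [ht.1, ht.2]
  have hφa : AntitoneOn (fun t : ℝ => 1 - t) (Icc 0 1) := fun s _ t _ hst => by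
    simpa only using sub_le_sub_left hst 1
  have := intrinsicDist_le_eVariationOn (S := S) (γ := γ ∘ fun t : ℝ => 1 - t) (zero_le_one' ℝ)
    (h1.comp (by fun_prop) hφ) (h4.comp hφ)
  simp only [Function.comp_apply, sub_zero, sub_self, h2, h3] at this
  exact (this.trans (eVariationOn.comp_le_of_antitoneOn γ _ hφa hφ)).trans_lt h5

theorem intrinsicDist_comm (x y : Euc n) : intrinsicDist S x y = intrinsicDist S y x :=
  le_antisymm (intrinsicDist_comm_le x y) (intrinsicDist_comm_le y x)

theorem intrinsicDist_triangle (x y z : Euc n) :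
    intrinsicDist S x z ≤ intrinsicDist S x y + intrinsicDist S y z := by
  by_cases hx : intrinsicDist S x y = ⊤
  · simp [hx]
  by_cases hy : intrinsicDist S y z = ⊤
  · simp [hy]
  refine ENNReal.le_of_forall_pos_le_add fun ε hε _ => ?_
  have hε2 : (ε / 2 : ℝ≥0∞) ≠ 0 := by simp [hε.ne']
  obtain ⟨γ, c1, a1, b1, m1, v1⟩ :=
    exists_path_of_intrinsicDist_lt (ENNReal.lt_add_right hx hε2)
  obtain ⟨δ, c2, a2, b2, m2, v2⟩ :=
    exists_path_of_intrinsicDist_lt (ENNReal.lt_add_right hy hε2)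
  set σ : ℝ → Euc n := fun t => if t ≤ 1 then γ t else δ (t - 1)
  have e1 : EqOn σ γ (Icc 0 1) := fun t ht => by simp [σ, ht.2]
  have e2 : EqOn σ (δ ∘ fun t => t - 1) (Icc 1 2) := fun t ht => by
    rcases ht.1.eq_or_lt with h | h
    · simp [σ, ← h, b1, a2]
    · simp [σ, not_le.2 h]
  have hφ : MapsTo (fun t : ℝ => t - 1) (Icc 1 2) (Icc 0 1) := fun t ht => by
    constructor <;> linarith [ht.1, ht.2]
  have hφm : MonotoneOn (fun t : ℝ => t - 1) (Icc 1 2) := fun s _ t _ hst => by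
    simpa using hst
  have hu : Icc (0:ℝ) 2 = Icc 0 1 ∪ Icc 1 2 := (Icc_union_Icc_eq_Icc (by simp) (by simp)).symm
  have hc : ContinuousOn σ (Icc 0 2) := by
    rw [hu]
    exact (c1.congr e1).union_of_isClosed ((c2.comp (by fun_prop) hφ).congr e2)
      isClosed_Icc isClosed_Icc
  have hm : MapsTo σ (Icc 0 2) S := by
    rw [hu]
    exact MapsTo.union (m1.congr e1.symm) ((m2.comp hφ).congr e2.symm)
  have key := intrinsicDist_le_eVariationOn (by norm_num) hc hm
  have hs : eVariationOn σ (Icc 0 2) = eVariationOn σ (Icc 0 1) + eVariationOn σ (Icc 1 2) := by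
    have := eVariationOn.Icc_add_Icc σ (s := univ) (zero_le_one' ℝ) (one_le_two) (mem_univ _)
    simpa using this.symm
  rw [hs, eVariationOn.congr e1, eVariationOn.congr e2] at key
  have h0 : σ 0 = x := by simp [σ, a1]
  have h2 : σ 2 = z := by norm_num [σ, b2]
  rw [h0, h2] at key
  calc _ ≤ _ := key
    _ ≤ (intrinsicDist S x y + ε / 2) + (intrinsicDist S y z + ε / 2) :=
      add_le_add v1.le ((eVariationOn.comp_le_of_monotoneOn δ _ hφm hφ).trans v2.le)
    _ = _ := by
      rw [add_add_add_comm, ENNReal.add_halves]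

theorem intrinsicDist_le_edist_of_segment_subset {x y : Euc n} (h : segment ℝ x y ⊆ S) :
    intrinsicDist S x y ≤ edist x y := by
  have hl : LipschitzWith (nndist x y) (AffineMap.lineMap x y : ℝ → Euc n) :=
    lipschitzWith_lineMap x y
  have := intrinsicDist_le_eVariationOn (S := S) (γ := fun t : ℝ => AffineMap.lineMap x y t)
    (zero_le_one' ℝ) hl.continuous.continuousOn (fun t ht => h (by
      rw [segment_eq_image_lineMap]; exact ⟨t, ht, rfl⟩))
  simp only [AffineMap.lineMap_apply_zero, AffineMap.lineMap_apply_one] at this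
  refine this.trans ?_
  have h2 := (hl.lipschitzOnWith (s := Icc 0 1)).comp_eVariationOn_le (g := id)
    (s := Icc (0:ℝ) 1) (fun _ h => h)
  refine h2.trans ?_
  have h3 : eVariationOn (id : ℝ → ℝ) (Icc 0 1) ≤ 1 := by
    have := (monotone_id (α := ℝ)).monotoneOn (Icc 0 1) |>.eVariationOn_eq
      (a := 0) (b := 1) (by simp) (by simp)
    simp only [inter_self, id, sub_zero, ENNReal.ofReal_one] at this
    exact this.le
  calc _ ≤ (nndist x y : ℝ≥0∞) * 1 := by gcongr
    _ = edist x y := by rw [mul_one, edist_nndist]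

theorem intrinsicDist_eq_edist_of_segment_subset {x y : Euc n} (h : segment ℝ x y ⊆ S) :
    intrinsicDist S x y = edist x y :=
  le_antisymm (intrinsicDist_le_edist_of_segment_subset h) (edist_le_intrinsicDist x y)

theorem intrinsicDist_eq_edist_of_mem_ball {p x y : Euc n} {r : ℝ} (h : ball p r ⊆ S)
    (hx : x ∈ ball p r) (hy : y ∈ ball p r) : intrinsicDist S x y = edist x y :=
  intrinsicDist_eq_edist_of_segment_subset (((convex_ball p r).segment_subset hx hy).trans h)

theorem continuousOn_intrinsicDist (hS : IsOpen S) (p : Euc n) :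
    ContinuousOn (intrinsicDist S p) S := by
  intro q hq
  obtain ⟨r, hr, hb⟩ := Metric.isOpen_iff.1 hS q hq
  have : ContinuousOn (intrinsicDist S p) (ball q r) := by
    rw [continuousOn_iff_continuous_domRestrict]
    refine continuous_of_le_add_edist 1 (by simp) fun x y => ?_
    have h := intrinsicDist_triangle (S := S) p y x
    rw [intrinsicDist_eq_edist_of_mem_ball hb y.2 x.2] at h
    rw [one_mul, edist_comm]
    exact h
  exact (this.continuousAt (ball_mem_nhds q hr)).continuousWithinAt

theorem tendsto_intrinsicDist (hS : IsOpen S) {p : Euc n} (hp : p ∈ S) {ι : Type*} {l : Filter ι}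
    {s : ι → Euc n} (hs : Tendsto s l (𝓝 p)) :
    Tendsto (fun i => intrinsicDist S (s i) p) l (𝓝 0) := by
  have := ((continuousOn_intrinsicDist hS p).continuousAt (hS.mem_nhds hp)).tendsto.comp hs
  rw [intrinsicDist_self hp] at this
  simpa only [Function.comp_def, intrinsicDist_comm p] using this

end IntrinsicDist

theorem ENNReal.limsup_add_le_limsup_add_limsup {ι : Type*} {l : Filter ι} (u v : ι → ℝ≥0∞) :
    limsup (fun i => u i + v i) l ≤ limsup u l + limsup v l := by
  by_cases hu : limsup u l = ⊤
  · simp [hu]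
  by_cases hv : limsup v l = ⊤
  · simp [hv]
  refine ENNReal.le_of_forall_pos_le_add fun ε hε _ => ?_
  have hε2 : (ε / 2 : ℝ≥0∞) ≠ 0 := by simp [hε.ne']
  refine limsup_le_of_le (h := ?_)
  filter_upwards [eventually_lt_of_limsup_lt (ENNReal.lt_add_right hu hε2),
    eventually_lt_of_limsup_lt (ENNReal.lt_add_right hv hε2)] with i h1 h2
  calc u i + v i ≤ (limsup u l + ε / 2) + (limsup v l + ε / 2) := add_le_add h1.le h2.le
    _ = _ := by rw [add_add_add_comm, ENNReal.add_halves]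

section EndDist

variable {n : ℕ} {S : Set (Euc n)}

/-- The asymptotic intrinsic distance from a sequence to a point. For a Cauchy sequence it is the
distance in the completion between the limit of the sequence and the point. -/
def endDist (S : Set (Euc n)) (a : ℕ → Euc n) (p : Euc n) : ℝ≥0∞ :=
  limsup (fun k => intrinsicDist S (a k) p) atTop

/-- A sequence that is Cauchy for the intrinsic metric. -/
def IsIntrinsicCauchy (S : Set (Euc n)) (a : ℕ → Euc n) : Prop :=
  ∀ ε : ℝ≥0∞, 0 < ε → ∃ N : ℕ, ∀ j ≥ N, ∀ k ≥ N, intrinsicDist S (a j) (a k) < ε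

variable {a b : ℕ → Euc n}

@[simp]
theorem endDist_const (p q : Euc n) : endDist S (fun _ => p) q = intrinsicDist S p q := by
  simp [endDist]

theorem isIntrinsicCauchy_const {p : Euc n} (hp : p ∈ S) : IsIntrinsicCauchy S fun _ => p :=
  fun ε hε => ⟨0, fun _ _ _ _ => by rwa [intrinsicDist_self hp]⟩

theorem endDist_le_add (p q : Euc n) :
    endDist S a p ≤ endDist S a q + intrinsicDist S q p := by
  refine (limsup_le_limsup (Eventually.of_forall fun k =>
    intrinsicDist_triangle (a k) q p)).trans ?_
  refine (ENNReal.limsup_add_le_limsup_add_limsup _ _).trans ?_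
  simp [endDist]

theorem limsup_intrinsicDist_le (p : Euc n) :
    limsup (fun k => intrinsicDist S (a k) (b k)) atTop ≤ endDist S a p + endDist S b p := by
  refine (limsup_le_limsup (Eventually.of_forall fun k =>
    intrinsicDist_triangle (a k) p (b k))).trans ?_
  simp only [intrinsicDist_comm p]
  exact ENNReal.limsup_add_le_limsup_add_limsup _ _

theorem edist_le_limsup_intrinsicDist {x y : Euc n} (ha : Tendsto a atTop (𝓝 x))
    (hb : Tendsto b atTop (𝓝 y)) :
    edist x y ≤ limsup (fun k => intrinsicDist S (a k) (b k)) atTop := by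
  rw [← (ha.edist hb).limsup_eq]
  exact limsup_le_limsup (Eventually.of_forall fun k => edist_le_intrinsicDist _ _)

theorem edist_le_endDist {x : Euc n} (ha : Tendsto a atTop (𝓝 x)) (p : Euc n) :
    edist x p ≤ endDist S a p :=
  edist_le_limsup_intrinsicDist ha tendsto_const_nhds

theorem IsIntrinsicCauchy.eventually_endDist_le (ha : IsIntrinsicCauchy S a) {ε : ℝ≥0∞}
    (hε : 0 < ε) : ∀ᶠ k in atTop, endDist S a (a k) ≤ ε := by
  obtain ⟨N, hN⟩ := ha ε hε
  filter_upwards [eventually_ge_atTop N] with k hk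
  refine limsup_le_of_le (h := ?_)
  filter_upwards [eventually_ge_atTop N] with j hj
  exact (hN j hj k hk).le

theorem endDist_le_of_tendsto (hS : IsOpen S) {r : ℕ → Euc n} {p : Euc n} (hp : p ∈ S)
    (hr : Tendsto r atTop (𝓝 p)) {c : ℕ → ℝ≥0∞} {C : ℝ≥0∞} (hc : Tendsto c atTop (𝓝 C))
    (h : ∀ᶠ i in atTop, endDist S a (r i) ≤ c i) : endDist S a p ≤ C := by
  have h1 := hc.add (tendsto_intrinsicDist hS hp hr)
  rw [add_zero] at h1
  refine ge_of_tendsto h1 ?_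
  filter_upwards [h] with i hi
  exact (endDist_le_add p (r i)).trans (by gcongr)

theorem exists_endDist_le_add (hS : IsOpen S) (haS : ∀ k, a k ∈ S)
    (ha : IsIntrinsicCauchy S a) (hb : IsIntrinsicCauchy S b) {L t ε : ℝ}
    (hL : limsup (fun k => intrinsicDist S (a k) (b k)) atTop = ENNReal.ofReal L)
    (ht : 0 < t) (htL : t < L) (hε : 0 < ε) :
    ∃ r ∈ S, endDist S a r ≤ ENNReal.ofReal (t + ε) ∧
      endDist S b r ≤ ENNReal.ofReal (L - t + ε) := by
  have hη : 0 < ε / 2 := by positivity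
  have f1 : ∃ᶠ k in atTop, ENNReal.ofReal t < intrinsicDist S (a k) (b k) :=
    frequently_lt_of_lt_limsup (h := by
      rw [hL]; exact (ENNReal.ofReal_lt_ofReal_iff (ht.trans htL)).2 htL)
  have f2 : ∀ᶠ k in atTop, intrinsicDist S (a k) (b k) < ENNReal.ofReal (L + ε / 2) :=
    eventually_lt_of_limsup_lt (by
      rw [hL]; exact (ENNReal.ofReal_lt_ofReal_iff (by linarith)).2 (by linarith))
  obtain ⟨k, k1, k2, k3, k4⟩ := (f1.and_eventually (f2.and
    ((ha.eventually_endDist_le (ENNReal.ofReal_pos.2 hη)).and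
      (hb.eventually_endDist_le (ENNReal.ofReal_pos.2 hη))))).exists
  obtain ⟨γ, hc, h0, h1, hm, hv⟩ := exists_path_of_intrinsicDist_lt k2
  have hg : ContinuousOn (fun τ => intrinsicDist S (a k) (γ τ)) (Icc 0 1) :=
    (continuousOn_intrinsicDist hS (a k)).comp hc hm
  obtain ⟨τ, hτ, hτt⟩ := intermediate_value_Icc (zero_le_one' ℝ) hg
    (show ENNReal.ofReal t ∈ _ by
      simp only [h0, h1, intrinsicDist_self (haS k)]
      exact ⟨zero_le, k1.le⟩)
  simp only at hτt
  have v1 : intrinsicDist S (a k) (γ τ) ≤ eVariationOn γ (Icc 0 τ) := by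
    have := intrinsicDist_le_eVariationOn hτ.1 (hc.mono (Icc_subset_Icc_right hτ.2))
      (hm.mono_left (Icc_subset_Icc_right hτ.2))
    rwa [h0] at this
  have v2 : intrinsicDist S (γ τ) (b k) ≤ eVariationOn γ (Icc τ 1) := by
    have := intrinsicDist_le_eVariationOn hτ.2 (hc.mono (Icc_subset_Icc_left hτ.1))
      (hm.mono_left (Icc_subset_Icc_left hτ.1))
    rwa [h1] at this
  have v3 : eVariationOn γ (Icc 0 1) = eVariationOn γ (Icc 0 τ) + eVariationOn γ (Icc τ 1) := by
    have := eVariationOn.Icc_add_Icc γ (s := univ) hτ.1 hτ.2 (mem_univ _)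
    simpa using this.symm
  have v4 : intrinsicDist S (b k) (γ τ) ≤ ENNReal.ofReal (L - t + ε / 2) := by
    rw [intrinsicDist_comm, ← ENNReal.add_le_add_iff_left (ENNReal.ofReal_ne_top (r := t)),
      ← ENNReal.ofReal_add ht.le (by linarith), ← hτt]
    refine (add_le_add v1 v2).trans ?_
    rw [← v3]
    exact hv.le.trans (ENNReal.ofReal_le_ofReal (by linarith))
  refine ⟨γ τ, hm hτ, ?_, ?_⟩
  · refine (endDist_le_add (γ τ) (a k)).trans ?_
    rw [hτt]
    refine (add_le_add_left k3 _).trans ?_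
    rw [← ENNReal.ofReal_add hη.le ht.le]
    exact ENNReal.ofReal_le_ofReal (by linarith)
  · refine (endDist_le_add (γ τ) (b k)).trans ?_
    refine (add_le_add k4 v4).trans ?_
    rw [← ENNReal.ofReal_add hη.le (by linarith)]
    exact ENNReal.ofReal_le_ofReal (by linarith)

theorem exists_endDist_le (hS : IsOpen S) (haS : ∀ k, a k ∈ S)
    (ha : IsIntrinsicCauchy S a) (hb : IsIntrinsicCauchy S b) {x : Euc n}
    (hx : Tendsto a atTop (𝓝 x)) {L t δ : ℝ}
    (hL : limsup (fun k => intrinsicDist S (a k) (b k)) atTop = ENNReal.ofReal L)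
    (ht : 0 < t) (htL : t < L) (hδ : 0 < δ)
    (hball : ∀ r ∈ S, endDist S a r ≤ ENNReal.ofReal (t + δ) →
      endDist S b r ≤ ENNReal.ofReal (L - t + δ) → ball r δ ⊆ S) :
    ∃ r ∈ S, endDist S a r ≤ ENNReal.ofReal t ∧ endDist S b r ≤ ENNReal.ofReal (L - t) := by
  have hpos : ∀ i : ℕ, 0 < δ * (1 / ((i : ℝ) + 1)) := fun i => by positivity
  have hle : ∀ i : ℕ, δ * (1 / ((i : ℝ) + 1)) ≤ δ := fun i => by
    have : 1 / ((i : ℝ) + 1) ≤ 1 := by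
      rw [div_le_one (by positivity)]; linarith [(Nat.cast_nonneg i : (0:ℝ) ≤ i)]
    nlinarith
  choose r hrS hra hrb using fun i => exists_endDist_le_add hS haS ha hb hL ht htL (hpos i)
  have hb' : ∀ i, r i ∈ closedBall x (t + δ) := fun i => by
    have h := (edist_le_endDist hx (r i)).trans (hra i)
    rw [edist_dist, ENNReal.ofReal_le_ofReal_iff (by linarith [hpos i])] at h
    rw [mem_closedBall, dist_comm]
    linarith [hle i]
  obtain ⟨p, -, φ, hφ, hp⟩ := tendsto_subseq_of_bounded isBounded_closedBall hb'
  have hpS : p ∈ S := by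
    obtain ⟨i, hi⟩ := ((Metric.tendsto_nhds.1 hp) δ hδ).exists
    refine hball (r (φ i)) (hrS _) ((hra _).trans (ENNReal.ofReal_le_ofReal ?_))
      ((hrb _).trans (ENNReal.ofReal_le_ofReal ?_)) ?_
    · linarith [hle (φ i)]
    · linarith [hle (φ i)]
    · rw [mem_ball, dist_comm]; exact hi
  have hlim : ∀ c : ℝ, Tendsto (fun i => ENNReal.ofReal (c + δ * (1 / ((φ i : ℕ) + 1 : ℝ)))) atTop
      (𝓝 (ENNReal.ofReal c)) := fun c => by
    refine ENNReal.tendsto_ofReal ?_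
    have := ((tendsto_one_div_add_atTop_nhds_zero_nat (𝕜 := ℝ)).comp hφ.tendsto_atTop).const_mul δ
      |>.const_add c
    simpa using this
  exact ⟨p, hpS, endDist_le_of_tendsto hS hpS hp (hlim t) (Eventually.of_forall fun i => hra _),
    endDist_le_of_tendsto hS hpS hp (hlim _) (Eventually.of_forall fun i => hrb _)⟩

end EndDist

section InnerProductGeometry

variable {E : Type*} [NormedAddCommGroup E] [InnerProductSpace ℝ E]

theorem eq_of_two_mul_le_norm_add {v w : E} {c : ℝ} (hv : ‖v‖ ≤ c) (hw : ‖w‖ ≤ c)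
    (h : 2 * c ≤ ‖v + w‖) : v = w := by
  have hc : 0 ≤ c := (norm_nonneg v).trans hv
  have hp := parallelogram_law_with_norm ℝ v w
  have h0 : ‖v - w‖ = 0 := by
    nlinarith [norm_nonneg v, norm_nonneg w, norm_nonneg (v - w), norm_nonneg (v + w)]
  exact sub_eq_zero.1 (norm_eq_zero.1 h0)

theorem norm_sub_lineMap_sq (x y z : E) (c : ℝ) :
    ‖z - AffineMap.lineMap x y c‖ ^ 2 =
      (1 - c) * ‖z - x‖ ^ 2 + c * ‖z - y‖ ^ 2 - c * (1 - c) * ‖x - y‖ ^ 2 := by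
  have h1 : z - AffineMap.lineMap x y c = (1 - c) • (z - x) + c • (z - y) := by
    rw [AffineMap.lineMap_apply_module]; module
  have h2 : x - y = (z - y) - (z - x) := by abel
  rw [h1, h2, norm_add_sq_real, norm_sub_sq_real (z - y), norm_smul, norm_smul,
    real_inner_smul_left, real_inner_smul_right, real_inner_comm (z - x), mul_pow, mul_pow,
    Real.norm_eq_abs, Real.norm_eq_abs, sq_abs, sq_abs]
  ring

theorem dist_lineMap_sq_le {x y z : E} {t δ : ℝ} (ht : 0 < t) (htL : t < dist x y) (hδ : 0 ≤ δ)
    (hx : dist x z ≤ t + δ) (hy : dist y z ≤ dist x y - t + δ) :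
    dist z (AffineMap.lineMap x y (t / dist x y)) ^ 2 ≤ 2 * δ * dist x y + δ ^ 2 := by
  have hL : 0 < dist x y := ht.trans htL
  obtain ⟨c, hc⟩ : ∃ c, c = t / dist x y := ⟨_, rfl⟩
  have htc : t = c * dist x y := by rw [hc]; field_simp
  have hc0 : 0 < c := hc ▸ div_pos ht hL
  have hc1 : c < 1 := by rw [hc, div_lt_one hL]; exact htL
  rw [← hc, dist_eq_norm z, norm_sub_lineMap_sq, ← dist_eq_norm, ← dist_eq_norm, ← dist_eq_norm,
    dist_comm z x, dist_comm z y]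
  generalize dist x y = L at *
  subst htc
  have e1 : dist x z ^ 2 ≤ (c * L + δ) ^ 2 := by gcongr
  have e2 : dist y z ^ 2 ≤ (L - c * L + δ) ^ 2 := by gcongr
  have e3 : 0 ≤ (2 * c - 1) ^ 2 * (δ * L) := by positivity
  have e4 : 0 ≤ δ * L := by positivity
  nlinarith [mul_le_mul_of_nonneg_left e1 (sub_nonneg.2 hc1.le),
    mul_le_mul_of_nonneg_left e2 hc0.le]

end InnerProductGeometry

section IsBetween

variable {n : ℕ} {S : Set (Euc n)} {a b : ℕ → Euc n} {L : ℝ}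

/-- `p` lies on a shortest route of length `L` from the limit of `a` to the limit of `b`, at
distance `t` from the former. -/
def IsBetween (S : Set (Euc n)) (a b : ℕ → Euc n) (L t : ℝ) (p : Euc n) : Prop :=
  p ∈ S ∧ endDist S a p ≤ ENNReal.ofReal t ∧ endDist S b p ≤ ENNReal.ofReal (L - t)

/-- Points that are nearly at level `t` between `a` and `b` stay away from the complement. -/
def HasInteriorLevels (S : Set (Euc n)) (a b : ℕ → Euc n) (L : ℝ) : Prop :=
  ∀ t, 0 < t → t < L → ∃ δ > 0, ∀ r ∈ S, endDist S a r ≤ ENNReal.ofReal (t + δ) →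
    endDist S b r ≤ ENNReal.ofReal (L - t + δ) → ball r δ ⊆ S

theorem IsBetween.le_intrinsicDist
    (hL : limsup (fun k => intrinsicDist S (a k) (b k)) atTop = ENNReal.ofReal L)
    {s t : ℝ} {p q : Euc n} (hs : 0 ≤ s) (ht : t ≤ L)
    (hp : IsBetween S a b L s p) (hq : IsBetween S a b L t q) :
    ENNReal.ofReal (t - s) ≤ intrinsicDist S p q := by
  have h1 := limsup_intrinsicDist_le (S := S) (a := a) (b := b) q
  rw [hL] at h1
  have h2 : ENNReal.ofReal L ≤ ENNReal.ofReal (L - (t - s)) + intrinsicDist S p q := by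
    refine h1.trans ((add_le_add ((endDist_le_add q p).trans (add_le_add_left hp.2.1 _))
      hq.2.2).trans ?_)
    rw [add_right_comm, ← ENNReal.ofReal_add hs (by linarith)]
    exact (add_le_add_left (ENNReal.ofReal_le_ofReal (by linarith)) _)
  by_contra! h
  have h3 := (ENNReal.ofReal_pos.1 (lt_of_le_of_lt zero_le h))
  have h4 : ENNReal.ofReal (L - (t - s)) + intrinsicDist S p q < ENNReal.ofReal L := by
    refine (ENNReal.add_lt_add_left ENNReal.ofReal_ne_top h).trans_le ?_
    rw [← ENNReal.ofReal_add (by linarith) h3.le]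
    exact ENNReal.ofReal_le_ofReal (by linarith)
  exact absurd h2 (not_le.2 h4)

theorem IsBetween.exists_step (hS : IsOpen S) (hb : IsIntrinsicCauchy S b)
    (hL : limsup (fun k => intrinsicDist S (a k) (b k)) atTop = ENNReal.ofReal L)
    (hlev : HasInteriorLevels S a b L) {s t : ℝ} {p : Euc n} (hs : 0 ≤ s) (hst : s < t)
    (htL : t < L) (hp : IsBetween S a b L s p) :
    ∃ r, IsBetween S a b L t r ∧ intrinsicDist S p r ≤ ENNReal.ofReal (t - s) := by
  obtain ⟨δ, hδ, hball⟩ := hlev t (hs.trans_lt hst) htL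
  have hadd : ∀ {r : Euc n} {c : ℝ}, s ≤ c → intrinsicDist S p r ≤ ENNReal.ofReal (c - s) →
      endDist S a r ≤ ENNReal.ofReal c := fun {r c} hc h => by
    refine (endDist_le_add r p).trans ((add_le_add hp.2.1 h).trans ?_)
    rw [← ENNReal.ofReal_add hs (by linarith)]
    exact ENNReal.ofReal_le_ofReal (by linarith)
  have hLp : limsup (fun k => intrinsicDist S p (b k)) atTop = ENNReal.ofReal (L - s) := by
    simp only [intrinsicDist_comm p]
    refine le_antisymm hp.2.2 ?_
    have h1 := limsup_intrinsicDist_le (S := S) (a := a) (b := b) p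
    rw [hL] at h1
    have h2 := h1.trans (add_le_add_left hp.2.1 _)
    rw [ENNReal.ofReal_sub _ hs]
    exact tsub_le_iff_left.2 h2
  obtain ⟨r, hr, h1, h2⟩ := exists_endDist_le hS (fun _ => hp.1) (isIntrinsicCauchy_const hp.1) hb
    tendsto_const_nhds hLp (sub_pos.2 hst) (by linarith) hδ (fun r hr h1 h2 => by
      rw [endDist_const] at h1
      refine hball r hr (hadd (by linarith) ?_) ?_
      · convert h1 using 2; ring
      · convert h2 using 2; ring)
  rw [endDist_const] at h1
  refine ⟨r, ⟨hr, hadd hst.le h1, ?_⟩, h1⟩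
  convert h2 using 2; ring

theorem IsBetween.exists_ray (hS : IsOpen S) (hb : IsIntrinsicCauchy S b)
    (hL : limsup (fun k => intrinsicDist S (a k) (b k)) atTop = ENNReal.ofReal L)
    (hlev : HasInteriorLevels S a b L) {t : ℝ} {p : Euc n} (ht : 0 < t) (htL : t < L)
    (hp : IsBetween S a b L t p) :
    ∃ u : Euc n, ‖u‖ = 1 ∧ ∀ s, 0 ≤ s → s < L - t → IsBetween S a b L (t + s) (p + s • u) := by
  have hinball : ∀ {c : ℝ} {q : Euc n}, 0 < c → c < L → IsBetween S a b L c q →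
      ∃ δ > 0, ball q δ ⊆ S := fun {c q} h1 h2 hq => by
    obtain ⟨δ, hδ, h⟩ := hlev c h1 h2
    exact ⟨δ, hδ, h q hq.1 (hq.2.1.trans (ENNReal.ofReal_le_ofReal (by linarith)))
      (hq.2.2.trans (ENNReal.ofReal_le_ofReal (by linarith)))⟩
  have hdist : ∀ {x y : Euc n} {c : ℝ}, 0 ≤ c → intrinsicDist S x y ≤ ENNReal.ofReal c →
      dist x y ≤ c := fun {x y c} hc h => by
    have := (edist_le_intrinsicDist x y).trans h
    rwa [edist_dist, ENNReal.ofReal_le_ofReal_iff hc] at this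
  obtain ⟨δ, hδ, hpδ⟩ := hinball ht htL hp
  obtain ⟨ε, hε, hεδ, hεL⟩ : ∃ ε > 0, ε < δ ∧ t + ε < L := by
    refine ⟨min δ (L - t) / 2, half_pos (lt_min hδ (by linarith)), ?_, ?_⟩
    · linarith [min_le_left δ (L - t)]
    · linarith [min_le_right δ (L - t)]
  obtain ⟨r, hr, hpr⟩ := hp.exists_step hS hb hL hlev ht.le (lt_add_of_pos_right t hε) hεL
  rw [add_sub_cancel_left] at hpr
  have hpr' : dist p r ≤ ε := hdist hε.le hpr
  have hrδ : r ∈ ball p δ := by rw [mem_ball, dist_comm]; linarith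
  have hpr2 : ε ≤ dist p r := by
    have := hp.le_intrinsicDist hL ht.le hεL.le hr
    rwa [intrinsicDist_eq_edist_of_mem_ball hpδ (mem_ball_self hδ) hrδ, edist_dist,
      ENNReal.ofReal_le_ofReal_iff dist_nonneg, add_sub_cancel_left] at this
  obtain ⟨u, hu⟩ : ∃ u : Euc n, u = ε⁻¹ • (r - p) := ⟨_, rfl⟩
  have hru : r = p + ε • u := by
    rw [hu, smul_inv_smul₀ hε.ne']; abel
  have hu1 : ‖u‖ = 1 := by
    rw [hu, norm_smul, ← dist_eq_norm, dist_comm, le_antisymm hpr' hpr2, norm_inv,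
      Real.norm_of_nonneg hε.le, inv_mul_cancel₀ hε.ne']
  have hdu : ∀ s s' : ℝ, dist (p + s • u) (p + s' • u) = |s - s'| := fun s s' => by
    rw [dist_add_left, dist_eq_norm, ← sub_smul, norm_smul, hu1, mul_one, Real.norm_eq_abs]
  have hp0 : p = p + (0:ℝ) • u := by simp
  refine ⟨u, hu1, fun s hs hsL => ?_⟩
  have hbase : ∀ s ∈ Icc 0 ε, IsBetween S a b L (t + s) (p + s • u) := fun s hs => by
    have hq : p + s • u ∈ ball p δ := by
      have := hdu s 0
      rw [← hp0, sub_zero, abs_of_nonneg hs.1] at this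
      rw [mem_ball, this]
      linarith [hs.2]
    refine ⟨hpδ hq, ?_, ?_⟩
    · refine (endDist_le_add _ p).trans ?_
      rw [intrinsicDist_eq_edist_of_mem_ball hpδ (mem_ball_self hδ) hq,
        ENNReal.ofReal_add ht.le hs.1]
      refine add_le_add hp.2.1 ?_
      have := hdu 0 s
      rw [← hp0, zero_sub, abs_neg, abs_of_nonneg hs.1] at this
      rw [edist_dist, this]
    · refine (endDist_le_add _ r).trans ?_
      rw [intrinsicDist_eq_edist_of_mem_ball hpδ hrδ hq, edist_dist, hru, hdu,
        abs_of_nonneg (sub_nonneg.2 hs.2), ← hru]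
      refine (add_le_add_left hr.2.2 _).trans ?_
      rw [← ENNReal.ofReal_add (by linarith) (by linarith [hs.2])]
      exact ENNReal.ofReal_le_ofReal (by linarith)
  rcases le_total s ε with hsε | hsε
  · exact hbase s ⟨hs, hsε⟩
  set A : Set ℝ := {T | ∀ σ ∈ Icc 0 T, IsBetween S a b L (t + σ) (p + σ • u)}
  have hclosed : IsClosed (A ∩ Icc ε s) := by
    refine IsSeqClosed.isClosed fun T T₀ hT hlim => ?_
    have hT₀ : T₀ ∈ Icc ε s := isClosed_Icc.mem_of_tendsto hlim (Eventually.of_forall fun i =>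
      (hT i).2)
    refine ⟨fun σ hσ => ?_, hT₀⟩
    rcases hσ.2.lt_or_eq with h | rfl
    · obtain ⟨i, hi⟩ := (hlim.eventually_const_lt h).exists
      exact (hT i).1 σ ⟨hσ.1, hi.le⟩
    have hbt : ∀ i, IsBetween S a b L (t + T i) (p + T i • u) := fun i =>
      (hT i).1 _ ⟨hε.le.trans (hT i).2.1, le_rfl⟩
    have hlim2 : Tendsto (fun i => p + T i • u) atTop (𝓝 (p + σ • u)) :=
      tendsto_const_nhds.add (hlim.smul_const u)
    have hS2 : p + σ • u ∈ S := by
      obtain ⟨η, hη, hball⟩ := hlev (t + σ) (by linarith [hT₀.1]) (by linarith [hT₀.2])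
      obtain ⟨i, hi⟩ := ((Metric.tendsto_nhds.1 hlim) η hη).exists
      rw [Real.dist_eq, abs_lt] at hi
      refine hball _ (hbt i).1 ((hbt i).2.1.trans (ENNReal.ofReal_le_ofReal (by linarith)))
        ((hbt i).2.2.trans (ENNReal.ofReal_le_ofReal (by linarith))) ?_
      rw [mem_ball, hdu, abs_lt]
      constructor <;> linarith
    exact ⟨hS2, endDist_le_of_tendsto hS hS2 hlim2
        (ENNReal.tendsto_ofReal (hlim.const_add t)) (Eventually.of_forall fun i => (hbt i).2.1),
      endDist_le_of_tendsto hS hS2 hlim2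
        (ENNReal.tendsto_ofReal ((hlim.const_add t).const_sub L))
        (Eventually.of_forall fun i => (hbt i).2.2)⟩
  refine hclosed.Icc_subset_of_forall_exists_gt hbase ?_ ⟨hsε, le_rfl⟩ s ⟨hs, le_rfl⟩
  rintro T ⟨hTA, hT⟩ y hy
  have hy : T < y := hy
  have hT0 : 0 ≤ T := hε.le.trans hT.1
  have hTL : t + T < L := by linarith [hT.2]
  have hTb := hTA T ⟨hT0, le_rfl⟩
  obtain ⟨η, hη, hball⟩ := hinball (by linarith) hTL hTb
  obtain ⟨κ, hκ, hκη, hκε, hκL, hκy⟩ :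
      ∃ κ > 0, κ < η ∧ κ ≤ ε ∧ t + T + κ < L ∧ T + κ ≤ y := by
    have h0 : 0 < min (min η (L - t - T)) (min ε (y - T)) :=
      lt_min (lt_min hη (by linarith)) (lt_min hε (by linarith))
    have h1 := min_le_left (min η (L - t - T)) (min ε (y - T))
    have h2 := min_le_right (min η (L - t - T)) (min ε (y - T))
    exact ⟨_, half_pos h0, by linarith [min_le_left η (L - t - T)],
      by linarith [min_le_left ε (y - T)], by linarith [min_le_right η (L - t - T)],
      by linarith [min_le_right ε (y - T)]⟩
  refine ⟨T + κ, fun σ hσ => ?_, by linarith, hκy⟩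
  rcases le_or_gt σ T with h | h
  · exact hTA σ ⟨hσ.1, h⟩
  obtain ⟨q, hq, hTq⟩ := hTb.exists_step hS hb hL hlev (by linarith)
    (show t + T < t + σ by linarith) (by linarith [hσ.2])
  rw [add_sub_add_left_eq_sub] at hTq
  have hTq' := hdist (by linarith) hTq
  have hback : IsBetween S a b L (t + (2 * T - σ)) (p + (2 * T - σ) • u) :=
    hTA _ ⟨by linarith [hσ.2, hT.1], by linarith⟩
  have hlow := hback.le_intrinsicDist hL (by linarith [hσ.2, hT.1]) (by linarith [hσ.2]) hq
  have hdback : dist (p + T • u) (p + (2 * T - σ) • u) = σ - T := by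
    rw [hdu, abs_of_nonneg (by linarith)]; ring
  rw [intrinsicDist_eq_edist_of_mem_ball hball (by rw [mem_ball, dist_comm]; linarith [hσ.2])
    (by rw [mem_ball, dist_comm]; linarith [hσ.2]), edist_dist,
    ENNReal.ofReal_le_ofReal_iff dist_nonneg] at hlow
  have heq := eq_of_two_mul_le_norm_add (v := (p + T • u) - (p + (2 * T - σ) • u))
    (w := q - (p + T • u)) (c := σ - T) (by rw [← dist_eq_norm, hdback])
    (by rwa [← dist_eq_norm, dist_comm]) (by
      rw [add_comm, sub_add_sub_cancel, ← dist_eq_norm, dist_comm]; linarith)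
  have hqσ : q = p + σ • u := by
    rw [eq_sub_iff_add_eq] at heq
    rw [← heq]; module
  exact hqσ ▸ hq

theorem dist_eq_and_openSegment_subset (hS : IsOpen S) (haS : ∀ k, a k ∈ S)
    (ha : IsIntrinsicCauchy S a) (hb : IsIntrinsicCauchy S b) {x y : Euc n}
    (hx : Tendsto a atTop (𝓝 x)) (hy : Tendsto b atTop (𝓝 y)) (hL0 : 0 < L)
    (hL : limsup (fun k => intrinsicDist S (a k) (b k)) atTop = ENNReal.ofReal L)
    (hlev : HasInteriorLevels S a b L) : dist x y = L ∧ openSegment ℝ x y ⊆ S := by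
  have hex : ∀ t, 0 < t → t < L → ∃ p, IsBetween S a b L t p := fun t ht htL => by
    obtain ⟨δ, hδ, hball⟩ := hlev t ht htL
    exact exists_endDist_le hS haS ha hb hx hL ht htL hδ hball
  have hdx : ∀ {t p}, 0 ≤ t → IsBetween S a b L t p → dist x p ≤ t := fun {t p} ht hp => by
    have := (edist_le_endDist hx p).trans hp.2.1
    rwa [edist_dist, ENNReal.ofReal_le_ofReal_iff ht] at this
  have hdy : ∀ {t p}, t ≤ L → IsBetween S a b L t p → dist y p ≤ L - t := fun {t p} ht hp => by
    have := (edist_le_endDist hy p).trans hp.2.2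
    rwa [edist_dist, ENNReal.ofReal_le_ofReal_iff (sub_nonneg.2 ht)] at this
  have hle : dist x y ≤ L := by
    have := edist_le_limsup_intrinsicDist (S := S) hx hy
    rwa [hL, edist_dist, ENNReal.ofReal_le_ofReal_iff hL0.le] at this
  have hge : L ≤ dist x y := by
    refine le_of_forall_pos_lt_add fun ε hε => ?_
    obtain ⟨t, ht, htL, htε⟩ : ∃ t > 0, t < L ∧ 4 * t < ε := by
      refine ⟨min L ε / 5, by positivity, ?_, ?_⟩
      · linarith [min_le_left L ε]
      · linarith [min_le_right L ε]
    obtain ⟨p, hp⟩ := hex t ht htL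
    obtain ⟨u, hu, hray⟩ := hp.exists_ray hS hb hL hlev ht htL
    rcases le_or_gt (L - t) t with h | h
    · linarith [dist_nonneg (x := x) (y := y)]
    have hz := hdy (by linarith) (hray (L - t - t) (by linarith) (by linarith))
    have hpz : dist p (p + (L - t - t) • u) = L - t - t := by
      rw [dist_self_add_right, norm_smul, hu, mul_one, Real.norm_of_nonneg (by linarith)]
    have h1 := dist_triangle4 p x y (p + (L - t - t) • u)
    have h2 := hdx ht.le hp
    rw [dist_comm] at h2
    linarith
  have hxy := le_antisymm hle hge
  refine ⟨hxy, ?_⟩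
  rw [openSegment_eq_image_lineMap]
  rintro _ ⟨c, hc, rfl⟩
  have hcL : c * L < L := by nlinarith [hc.2]
  have hcL0 : 0 < c * L := mul_pos hc.1 hL0
  obtain ⟨p, hp⟩ := hex (c * L) hcL0 hcL
  have h := dist_lineMap_sq_le (x := x) (y := y) (z := p) (δ := 0) hcL0 (by rwa [hxy]) le_rfl
    (by rw [add_zero]; exact hdx hcL0.le hp) (by rw [add_zero, hxy]; exact hdy hcL.le hp)
  rw [hxy, mul_div_cancel_right₀ _ hL0.ne'] at h
  have h0 : dist p (AffineMap.lineMap x y c) = 0 := by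
    nlinarith [dist_nonneg (x := p) (y := AffineMap.lineMap x y c)]
  exact dist_eq_zero.1 h0 ▸ hp.1

end IsBetween

section HausdorffBoundary

variable {n : ℕ} {U V : Set (Euc n)}

theorem hbEquiv_equivalence (U : Set (Euc n)) : Equivalence (HBEquiv U) where
  refl s := by
    simp only [HBEquiv, intrinsicDist_self (s.mem _)]
    exact tendsto_const_nhds
  symm {s t} h := by
    simpa only [HBEquiv, intrinsicDist_comm] using h
  trans {s t r} h1 h2 := by
    have := Tendsto.add (show Tendsto _ _ _ from h1) (show Tendsto _ _ _ from h2)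
    rw [add_zero] at this
    exact tendsto_of_tendsto_of_tendsto_of_le_of_le tendsto_const_nhds this
      (fun _ => zero_le) fun k => intrinsicDist_triangle _ _ _

theorem hbEquiv_out_mk (s : HBSeq U) : HBEquiv U (Quot.out (Quot.mk (HBEquiv U) s)) s :=
  (hbEquiv_equivalence U).eqvGen_iff.1 (Quot.eqvGen_exact (Quot.out_eq _))

theorem HBEquiv.tendsto {s t : HBSeq U} (h : HBEquiv U s t) {x : Euc n}
    (ht : Tendsto t.seq atTop (𝓝 x)) : Tendsto s.seq atTop (𝓝 x) := by
  have h0 : Tendsto (fun k => edist (s.seq k) (t.seq k)) atTop (𝓝 0) :=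
    tendsto_of_tendsto_of_tendsto_of_le_of_le tendsto_const_nhds h
      (fun _ => zero_le) fun k => edist_le_intrinsicDist _ _
  rw [tendsto_iff_edist_tendsto_0] at ht ⊢
  have := h0.add ht
  rw [add_zero] at this
  exact tendsto_of_tendsto_of_tendsto_of_le_of_le tendsto_const_nhds this
      (fun _ => zero_le) fun k => edist_triangle _ _ _

theorem HBSeq.isIntrinsicCauchy (s : HBSeq U) : IsIntrinsicCauchy U s.seq := s.cauchy

theorem HBSeq.cauchySeq (s : HBSeq U) : CauchySeq s.seq := by
  rw [EMetric.cauchySeq_iff]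
  intro ε hε
  obtain ⟨N, hN⟩ := s.cauchy ε hε
  exact ⟨N, fun j hj k hk => (edist_le_intrinsicDist _ _).trans_lt (hN j hj k hk)⟩

theorem HBSeq.mem_frontier_of_tendsto (hU : IsOpen U) (s : HBSeq U) {x : Euc n}
    (hs : Tendsto s.seq atTop (𝓝 x)) : x ∈ frontier U := by
  rw [hU.frontier_eq]
  exact ⟨mem_closure_of_tendsto hs (Eventually.of_forall s.mem),
    fun hx => s.notConv ⟨x, hx, tendsto_intrinsicDist hU hx hs⟩⟩

theorem tendsto_hbSupport (a : HausdorffBoundary U) :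
    Tendsto (Quot.out a).seq atTop (𝓝 (hbSupport a)) :=
  (Quot.out a).cauchySeq.tendsto_limUnder

theorem hbSupport_mem_frontier (hU : IsOpen U) (a : HausdorffBoundary U) :
    hbSupport a ∈ frontier U :=
  (Quot.out a).mem_frontier_of_tendsto hU (tendsto_hbSupport a)

theorem edist_hbSupport_le_hbDist (a b : HausdorffBoundary U) :
    edist (hbSupport a) (hbSupport b) ≤ hbDist a b :=
  edist_le_limsup_intrinsicDist (tendsto_hbSupport a) (tendsto_hbSupport b)

theorem GeneratesEndpoint.hbSupport_eq {x y : Euc n} {a : HausdorffBoundary U}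
    (h : GeneratesEndpoint U x y a) : hbSupport a = x := by
  obtain ⟨s, rfl, -, hs⟩ := h
  exact tendsto_nhds_unique (tendsto_hbSupport _) ((hbEquiv_out_mk s).tendsto hs)

theorem hbDist_eq_of_generatesEndpoint {x y : Euc n} {a b : HausdorffBoundary U}
    (hxy : openSegment ℝ x y ⊆ U) (ha : GeneratesEndpoint U x y a)
    (hb : GeneratesEndpoint U y x b) : hbDist a b = edist x y := by
  refine le_antisymm ?_ ?_
  · obtain ⟨s, rfl, hs, hsx⟩ := ha
    obtain ⟨t, rfl, ht, hty⟩ := hb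
    have h1 : Tendsto _ _ _ := hbEquiv_out_mk s
    have h2 : Tendsto _ _ _ := (hbEquiv_equivalence U).symm (hbEquiv_out_mk t)
    have h3 := (h1.add (hsx.edist hty)).add h2
    rw [zero_add, add_zero] at h3
    rw [← h3.limsup_eq]
    refine limsup_le_limsup (Eventually.of_forall fun k => ?_)
    refine (intrinsicDist_triangle _ (t.seq k) _).trans (add_le_add_left ?_ _)
    refine (intrinsicDist_triangle _ (s.seq k) _).trans (add_le_add_right ?_ _)
    refine intrinsicDist_le_edist_of_segment_subset (Subset.trans ?_ hxy)
    exact (convex_openSegment x y).segment_subset (hs k) (openSegment_symm ℝ y x ▸ ht k)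
  · have := edist_hbSupport_le_hbDist a b
    rwa [ha.hbSupport_eq, hb.hbSupport_eq] at this

theorem exists_hbSeq_near (hV : IsOpen V) {p : Euc n} (hp : p ∈ V) {δ : ℝ}
    (hball : ¬ ball p δ ⊆ V) :
    ∃ c : HBSeq V, ∀ k, intrinsicDist V (c.seq k) p ≤ ENNReal.ofReal δ := by
  obtain ⟨q, hqb, hqV⟩ := not_subset.1 hball
  obtain ⟨z, hz, hzd⟩ := hV.isClosed_compl.exists_infDist_eq_dist ⟨q, hqV⟩ p
  have hsub : ball p (dist p z) ⊆ V := fun w hw => by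
    by_contra hwV
    have := infDist_le_dist_of_mem (x := p) (s := Vᶜ) hwV
    rw [mem_ball, dist_comm] at hw
    linarith
  have hpz : 0 < dist p z := dist_pos.2 fun h => hz (h ▸ hp)
  have hzδ : dist p z ≤ δ := by
    have := infDist_le_dist_of_mem (x := p) (s := Vᶜ) hqV
    rw [mem_ball, dist_comm] at hqb
    linarith
  set c : ℕ → Euc n := fun k => AffineMap.lineMap p z (1 - 1 / ((k : ℝ) + 1))
  have hcb : ∀ k, c k ∈ ball p (dist p z) := fun k => by
    have h1 : 0 < 1 / ((k : ℝ) + 1) := by positivity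
    have h2 : 1 / ((k : ℝ) + 1) ≤ 1 := by
      rw [div_le_one (by positivity)]; linarith [(Nat.cast_nonneg k : (0:ℝ) ≤ k)]
    rw [mem_ball, dist_lineMap_left, Real.norm_of_nonneg (by linarith)]
    nlinarith
  have hcz : Tendsto c atTop (𝓝 z) := by
    have h1 : Tendsto (fun k : ℕ => 1 - 1 / ((k : ℝ) + 1)) atTop (𝓝 1) := by
      simpa using (tendsto_one_div_add_atTop_nhds_zero_nat (𝕜 := ℝ)).const_sub 1
    have h2 : Continuous (AffineMap.lineMap p z : ℝ → Euc n) := AffineMap.lineMap_continuous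
    simpa [c, Function.comp_def] using (h2.tendsto 1).comp h1
  refine ⟨⟨c, fun k => hsub (hcb k), fun ε hε => ?_, ?_⟩, fun k => ?_⟩
  · obtain ⟨N, hN⟩ := EMetric.cauchySeq_iff.1 hcz.cauchySeq ε hε
    refine ⟨N, fun j hj k hk => ?_⟩
    rw [intrinsicDist_eq_edist_of_mem_ball hsub (hcb j) (hcb k)]
    exact hN j hj k hk
  · rintro ⟨u, hu, hcu⟩
    have : Tendsto c atTop (𝓝 u) := by
      rw [tendsto_iff_edist_tendsto_0]
      exact tendsto_of_tendsto_of_tendsto_of_le_of_le tendsto_const_nhds hcu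
        (fun _ => zero_le) fun k => edist_le_intrinsicDist _ _
    exact hz (tendsto_nhds_unique hcz this ▸ hu)
  · rw [intrinsicDist_eq_edist_of_mem_ball hsub (hcb k) (mem_ball_self hpz), edist_dist]
    exact ENNReal.ofReal_le_ofReal ((mem_ball.1 (hcb k)).le.trans hzδ)

theorem hbDist_mk_le (a : HausdorffBoundary V) (c : HBSeq V) {p : Euc n} {δ : ℝ≥0∞}
    (hc : ∀ k, intrinsicDist V (c.seq k) p ≤ δ) :
    hbDist a (Quot.mk _ c) ≤ endDist V (Quot.out a).seq p + δ := by
  refine (limsup_intrinsicDist_le p).trans (add_le_add_right ?_ _)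
  have h : Tendsto _ _ _ := (hbEquiv_out_mk c).add_const δ
  rw [zero_add] at h
  rw [← h.limsup_eq]
  exact limsup_le_limsup (Eventually.of_forall fun k =>
    (intrinsicDist_triangle _ (c.seq k) p).trans (add_le_add_right (hc k) _))

theorem IsHBIsometry.hasInteriorLevels (hU : IsOpen U) (hV : IsOpen V)
    {f : HausdorffBoundary U → HausdorffBoundary V} (hf : IsHBIsometry f)
    {a b : HausdorffBoundary U}
    (hseg : openSegment ℝ (hbSupport a) (hbSupport b) ⊆ U) :
    HasInteriorLevels V (Quot.out (f a)).seq (Quot.out (f b)).seq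
      (dist (hbSupport a) (hbSupport b)) := by
  intro t ht htL
  generalize hx : hbSupport a = x at *
  generalize hy : hbSupport b = y at *
  have hL : 0 < dist x y := ht.trans htL
  have hz : (AffineMap.lineMap x y (t / dist x y) : Euc n) ∈ U := hseg (by
    rw [openSegment_eq_image_lineMap]
    exact ⟨_, ⟨div_pos ht hL, (div_lt_one hL).2 htL⟩, rfl⟩)
  obtain ⟨η, hη, hηU⟩ := Metric.isOpen_iff.1 hU _ hz
  obtain ⟨δ, hδ, hδη⟩ : ∃ δ > 0, 2 * (2 * δ) * dist x y + (2 * δ) ^ 2 < η ^ 2 := by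
    have hcont : Tendsto (fun δ : ℝ => 2 * (2 * δ) * dist x y + (2 * δ) ^ 2) (𝓝[>] 0) (𝓝 0) := by
      have : Continuous fun δ : ℝ => 2 * (2 * δ) * dist x y + (2 * δ) ^ 2 := by fun_prop
      simpa using (this.tendsto 0).mono_left nhdsWithin_le_nhds
    obtain ⟨δ, h1, h2⟩ := ((hcont.eventually_lt_const (pow_pos hη 2)).and
      self_mem_nhdsWithin).exists
    exact ⟨δ, h2, h1⟩
  refine ⟨δ, hδ, fun r hr hra hrb => ?_⟩
  by_contra hball
  obtain ⟨c, hc⟩ := exists_hbSeq_near hV hr hball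
  obtain ⟨w, hw⟩ := hf.1.2 (Quot.mk _ c)
  have key : ∀ (d : HausdorffBoundary U) (s : ℝ), 0 ≤ s →
      endDist V (Quot.out (f d)).seq r ≤ ENNReal.ofReal (s + δ) →
      dist (hbSupport d) (hbSupport w) ≤ s + 2 * δ := fun d s hs h => by
    have h1 := edist_hbSupport_le_hbDist d w
    rw [← hf.2, hw] at h1
    have h2 := h1.trans ((hbDist_mk_le _ c hc).trans (add_le_add_left h _))
    rw [← ENNReal.ofReal_add (by linarith) hδ.le, edist_dist,
      ENNReal.ofReal_le_ofReal_iff (by linarith)] at h2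
    linarith
  have h1 := key a t ht.le hra
  have h2 := key b (dist x y - t) (by linarith) hrb
  rw [hx] at h1
  rw [hy] at h2
  have h3 := dist_lineMap_sq_le ht htL (by linarith) h1 h2
  have h4 := hbSupport_mem_frontier hU w
  rw [hU.frontier_eq] at h4
  exact h4.2 (hηU (mem_ball.2 (lt_of_pow_lt_pow_left₀ 2 hη.le (h3.trans_lt hδη))))

end HausdorffBoundary

/-- Lemma 2.3 (invariance of a boundary interval): an isometry of Hausdorff
boundaries in the relative metrics takes a boundary interval `]x,y[` of `U`
to a boundary interval `]x',y'[` of `V` of the same length. -/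
theorem boundary_interval_invariance
    (n : ℕ) (hn : 2 ≤ n) (U V : Set (Euc n))
    (hU : IsEucDomain U) (hV : IsEucDomain V) (hU' : U ≠ univ) (hV' : V ≠ univ)
    (f : HausdorffBoundary U → HausdorffBoundary V) (hf : IsHBIsometry f)
    (x y : Euc n) (hxy : IsBoundaryInterval U x y)
    (xt yt : HausdorffBoundary U)
    (hxt : GeneratesEndpoint U x y xt) (hyt : GeneratesEndpoint U y x yt) :
    IsBoundaryInterval V (hbSupport (f xt)) (hbSupport (f yt)) ∧
      dist (hbSupport (f xt)) (hbSupport (f yt)) = dist x y := by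
  have hx := hxt.hbSupport_eq
  have hy := hyt.hbSupport_eq
  have hL0 : 0 < dist x y := dist_pos.2 hxy.1
  have hL : hbDist (f xt) (f yt) = ENNReal.ofReal (dist x y) := by
    rw [hf.2, hbDist_eq_of_generatesEndpoint hxy.2.2.2 hxt hyt, edist_dist]
  have hlev := hf.hasInteriorLevels hU.1 hV.1 (a := xt) (b := yt) (by rw [hx, hy]; exact hxy.2.2.2)
  rw [hx, hy] at hlev
  obtain ⟨hdist, hsub⟩ := dist_eq_and_openSegment_subset hV.1 (Quot.out (f xt)).mem
    (Quot.out (f xt)).isIntrinsicCauchy (Quot.out (f yt)).isIntrinsicCauchy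
    (tendsto_hbSupport _) (tendsto_hbSupport _) hL0 hL hlev
  exact ⟨⟨dist_pos.1 (hdist ▸ hL0), hbSupport_mem_frontier hV.1 _, hbSupport_mem_frontier hV.1 _,
    hsub⟩, hdist⟩
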